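/- Context-suffixes are disconnected: Let N = ⟨w, ↷1, ↷2⟩ be a collapse-free 2-NW whose first position 0 executes an order-1 push ↑1 with ↷1-pops y_1 < ... < y_m. For each i, define ctxt-suffix(y_i) = {x : y_i < x < ctxt-pop(y_i)} if y_i has a context-pop, and ctxt-suffix(y_i) = {x : x > y_i} if y_i is top-level. Then every edge of ↷1 and every edge of ↷2 having one endpoint in ctxt-suffix(y_i) has both endpoints in ctxt-suffix(y_i). -/

import Mathlib

/-- Order-2 stack operations over stack alphabet `S`. -/
inductive Op (S : Type) : Type where
  | push1 : S → Op S
  | pop1  : Op S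
  | push2 : Op S
  | pop2  : Op S
  | collapse : Op S
  deriving DecidableEq

/-- Annotated stack symbol: (symbol, collapse link, position annotation). -/
abbrev ASym (S : Type) : Type := S × ℕ × ℤ
/-- Annotated order-1 stack, topmost symbol first. -/
abbrev Stk1 (S : Type) : Type := List (ASym S)
/-- Annotated order-2 stack: list of (position annotation, order-1 stack), topmost first.
In `[[u_1][u_2] ⋯ [u_n]]` the topmost stack `u_n` comes first in the list. -/
abbrev Stk2 (S : Type) : Type := List (ℤ × Stk1 S)

/-- The initial order-2 stack `[[]]`, its unique (empty) order-1 stack annotated `-1`. -/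
def initStk (S : Type) : Stk2 S := [(-1, ([] : Stk1 S))]

/-- One step of the annotated semantics; `p` is the current position.
`push1 s` records the collapse link `n-1` (number of stacks below the top) and the
position annotation `p`; `push2` duplicates the top stack annotating the copy with `p`;
`collapse` keeps the bottom `i` order-1 stacks, where `i` is the collapse link of the
topmost symbol.  Undefined operations yield `none`. -/
def step {S : Type} (p : ℕ) (op : Op S) (W : Stk2 S) : Option (Stk2 S) :=
  match op, W with
  | .push2, t :: rest => some (((p : ℤ), t.2) :: t :: rest)
  | .pop2, _ :: t :: rest => some (t :: rest)
  | .push1 s, (a, u) :: rest => some ((a, (s, rest.length, (p : ℤ)) :: u) :: rest)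
  | .pop1, (a, _ :: u) :: rest => some ((a, u) :: rest)
  | .collapse, (_, (_, i, _) :: _) :: _ =>
      if 1 ≤ i ∧ i < W.length then some (W.drop (W.length - i)) else none
  | _, _ => none

def runFrom {S : Type} (p : ℕ) (W : Stk2 S) : List (Op S) → Option (Stk2 S)
  | [] => some W
  | op :: rest => (step p op W).bind fun W' => runFrom (p + 1) W' rest

/-- `stkAt ops j` is the annotated order-2 stack `W_j` after executing `op_0 ⋯ op_j`
(for `j = -1` this is the initial stack `[[]]`). -/
def stkAt {S : Type} (ops : List (Op S)) (j : ℤ) : Option (Stk2 S) :=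
  runFrom 0 (initStk S) (ops.take (j + 1).toNat)

/-- A nonempty sequence of operations is valid if every operation is defined,
starting from the empty order-2 stack `[[]]`. -/
def Valid {S : Type} (ops : List (Op S)) : Prop :=
  ops ≠ [] ∧ (runFrom 0 (initStk S) ops).isSome

/-- `push1At ops j` is `push1(j)`: the position annotation of the topmost symbol of the
topmost order-1 stack of `W_j`, or `-1` if that stack is empty (also `-1` for `j = -1`). -/
def push1At {S : Type} (ops : List (Op S)) (j : ℤ) : ℤ :=
  match stkAt ops j with
  | some ((_, (_, _, p) :: _) :: _) => p
  | _ => -1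

/-- `Push2At ops j` is `Push2(j)`: the position annotation of the topmost order-1 stack
of `W_j` (`-1` for `j = -1`). -/
def Push2At {S : Type} (ops : List (Op S)) (j : ℤ) : ℤ :=
  match stkAt ops j with
  | some ((a, _) :: _) => a
  | _ => -1

/-- The order-1 nesting relation `i ↷1 j` of the 2-NW generated by `ops`. -/
def Nest1 {S : Type} (ops : List (Op S)) (i j : ℕ) : Prop :=
  ops[j]? = some Op.pop1 ∧ (i : ℤ) = push1At ops ((j : ℤ) - 1)

/-- The order-2 nesting relation `i ↷2 j` of the 2-NW generated by `ops`:
either `j` is a `↓2` popping the order-1 stack created at `i`, or `j` is a collapse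
and `i ≥ 0` is the position annotation of one of the order-1 stacks removed by it
(the removed stacks are the topmost `|W_{j-1}| - |W_j|` ones). -/
def Nest2 {S : Type} (ops : List (Op S)) (i j : ℕ) : Prop :=
  (ops[j]? = some Op.pop2 ∧ (i : ℤ) = Push2At ops ((j : ℤ) - 1)) ∨
  (ops[j]? = some Op.collapse ∧
    ∃ W W' : Stk2 S, stkAt ops ((j : ℤ) - 1) = some W ∧ stkAt ops (j : ℤ) = some W' ∧
      ∃ d : ℕ, d < W.length - W'.length ∧ ∃ e, W[d]? = some e ∧ e.1 = (i : ℤ))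

/-- `x` is top-level: no `↷2` edge strictly encloses `x`. -/
def TopLevel {S : Type} (ops : List (Op S)) (x : ℕ) : Prop :=
  ¬ ∃ z y, Nest2 ops z y ∧ z < x ∧ x < y

/-- `CtxtPop ops x y`: `y` is the context-pop of `x`, i.e. the order-2 pop of the
innermost `↷2` edge enclosing `x`. -/
def CtxtPop {S : Type} (ops : List (Op S)) (x y : ℕ) : Prop :=
  ∃ z, Nest2 ops z y ∧ z < x ∧ x < y ∧
    ¬ ∃ z' y', Nest2 ops z' y' ∧ z < z' ∧ z' < x ∧ x < y' ∧ y' < y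

theorem runFrom_append {S : Type} (l₁ l₂ : List (Op S)) : ∀ (p : ℕ) (W : Stk2 S),
    runFrom p W (l₁ ++ l₂) = (runFrom p W l₁).bind fun W' => runFrom (p + l₁.length) W' l₂ := by
  induction l₁ with
  | nil => intro p W; simp [runFrom]
  | cons o l ih =>
    intro p W
    simp only [List.cons_append, runFrom]
    cases h : step p o W with
    | none => simp
    | some W' => simp [ih, Nat.add_assoc, Nat.add_comm 1]

/-- Stack before executing position `n`. -/
def st {S : Type} (ops : List (Op S)) (n : ℕ) : Option (Stk2 S) :=
  runFrom 0 (initStk S) (ops.take n)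

theorem stkAt_pred {S : Type} (ops : List (Op S)) (j : ℕ) :
    stkAt ops ((j : ℤ) - 1) = st ops j := by
  simp [stkAt, st]

theorem st_succ {S : Type} (ops : List (Op S)) (n : ℕ) (o : Op S) (h : ops[n]? = some o) :
    st ops (n + 1) = (st ops n).bind (step n o) := by
  obtain ⟨hn, rfl⟩ := List.getElem?_eq_some_iff.1 h
  unfold st
  rw [List.take_succ_eq_append_getElem hn, runFrom_append]
  have : min n ops.length = n := by omega
  simp [runFrom, this]

theorem st_some {S : Type} (ops : List (Op S)) (hv : Valid ops) (n : ℕ) :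
    ∃ W, st ops n = some W := by
  have h := hv.2
  rw [← List.take_append_drop n ops, runFrom_append] at h
  unfold st
  cases h' : runFrom 0 (initStk S) (ops.take n) with
  | none => simp [h'] at h
  | some W => exact ⟨W, rfl⟩

/-- all stack annotations satisfy `P`, all symbol annotations satisfy `Q` -/
def AllAnn {S : Type} (P Q : ℤ → Prop) (W : Stk2 S) : Prop :=
  ∀ e ∈ W, P e.1 ∧ ∀ s ∈ e.2, Q s.2.2

theorem AllAnn.step {S : Type} {P Q : ℤ → Prop} {W W' : Stk2 S} {p : ℕ} {o : Op S}
    (hP : P p) (hQ : Q p) (ho : o ≠ .collapse) (hs : step p o W = some W')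
    (h : AllAnn P Q W) : AllAnn P Q W' := by
  unfold _root_.step at hs
  split at hs
  all_goals simp at hs ho
  all_goals subst hs
  all_goals simp [AllAnn] at h ⊢
  all_goals grind

structure Base {S : Type} (n : ℕ) (W : Stk2 S) : Prop where
  ann : AllAnn (fun x => -1 ≤ x ∧ x < n) (fun x => 0 ≤ x ∧ x < n) W
  pw : W.Pairwise (fun e f => f.1 < e.1)
  pw1 : ∀ e ∈ W, e.2.Pairwise (fun s t => t.2.2 < s.2.2)

theorem Base.step {S : Type} {W W' : Stk2 S} {p : ℕ} {o : Op S}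
    (ho : o ≠ .collapse) (hs : step p o W = some W')
    (h : Base p W) : Base (p+1) W' := by
  obtain ⟨h1, h2, h3⟩ := h
  refine ⟨?_, ?_, ?_⟩
  · refine AllAnn.step (by simp) (by simp) ho hs ?_
    intro e he
    refine ⟨?_, fun s hs => ?_⟩
    · have := (h1 e he).1; push_cast; omega
    · have := (h1 e he).2 s hs; push_cast; omega
  all_goals
    unfold _root_.step at hs
    split at hs
    all_goals simp at hs ho
    all_goals subst hs
    all_goals simp [AllAnn] at h1 h2 h3 ⊢
    all_goals grind

theorem st_base {S : Type} (ops : List (Op S)) (hcf : Op.collapse ∉ ops) (n : ℕ)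
    (hn : n ≤ ops.length) (W : Stk2 S) (hW : st ops n = some W) : Base n W := by
  induction n generalizing W with
  | zero =>
    simp [st, runFrom, initStk] at hW
    subst hW
    constructor <;> simp [AllAnn]
  | succ n ih =>
    have hl : n < ops.length := by omega
    rw [st_succ ops n _ (List.getElem?_eq_getElem hl)] at hW
    obtain ⟨V, hV, hs⟩ := Option.bind_eq_some_iff.1 hW
    refine Base.step ?_ hs (ih (by omega) V hV)
    intro h; exact hcf (h ▸ List.getElem_mem hl)

theorem ann_mono {S : Type} (ops : List (Op S)) (hv : Valid ops) (hcf : Op.collapse ∉ ops)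
    {P Q : ℤ → Prop} (m n : ℕ) (hmn : m ≤ n) (hn : n ≤ ops.length)
    (hP : ∀ k : ℕ, m ≤ k → P k) (hQ : ∀ k : ℕ, m ≤ k → Q k)
    (W V : Stk2 S) (hW : st ops m = some W) (hV : st ops n = some V)
    (h : AllAnn P Q W) : AllAnn P Q V := by
  induction n, hmn using Nat.le_induction generalizing V with
  | base => rw [hW] at hV; cases hV; exact h
  | succ n hmn ih =>
    have hl : n < ops.length := by omega
    rw [st_succ ops n _ (List.getElem?_eq_getElem hl)] at hV
    obtain ⟨U, hU, hs⟩ := Option.bind_eq_some_iff.1 hV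
    refine AllAnn.step (hP n hmn) (hQ n hmn) ?_ hs (ih (by omega) U hU)
    intro h; exact hcf (h ▸ List.getElem_mem hl)

theorem Nest1.elim {S : Type} {ops : List (Op S)} {i j : ℕ} (h : Nest1 ops i j) :
    ops[j]? = some Op.pop1 ∧ ∃ a s k u R, st ops j = some ((a, (s, k, (i : ℤ)) :: u) :: R) := by
  refine ⟨h.1, ?_⟩
  have h2 := h.2
  unfold push1At at h2
  rw [stkAt_pred] at h2
  split at h2
  · rename_i heq; subst h2; exact ⟨_, _, _, _, _, heq⟩
  · omega

theorem Nest2.elim {S : Type} {ops : List (Op S)} (hcf : Op.collapse ∉ ops) {i j : ℕ}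
    (h : Nest2 ops i j) :
    ops[j]? = some Op.pop2 ∧ ∃ u R, st ops j = some (((i : ℤ), u) :: R) := by
  rcases h with h | h
  · refine ⟨h.1, ?_⟩
    have h2 := h.2
    unfold Push2At at h2
    rw [stkAt_pred] at h2
    split at h2
    · rename_i heq; subst h2; exact ⟨_, _, heq⟩
    · omega
  · exact absurd (List.mem_of_getElem? h.1) hcf

theorem Nest2.intro {S : Type} {ops : List (Op S)} {i j : ℕ} {u R}
    (h : ops[j]? = some Op.pop2) (h2 : st ops j = some (((i : ℤ), u) :: R)) : Nest2 ops i j := by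
  left
  refine ⟨h, ?_⟩
  unfold Push2At
  rw [stkAt_pred, h2]

/-- the stack is `R`, with a stack annotated `a` above, and only new material above it -/
def SufInv {S : Type} (y : ℕ) (a : ℤ) (R : Stk2 S) (W : Stk2 S) : Prop :=
  ∃ L u, W = L ++ (a, u) :: R ∧ AllAnn (fun x => (y : ℤ) < x) (fun x => (y : ℤ) < x) L ∧
    ∀ s ∈ u, (y : ℤ) < s.2.2

theorem SufInv.step {S : Type} {y p : ℕ} {a : ℤ} {R W W' : Stk2 S} {o : Op S} (hp : y < p)
    (ho : o ≠ .collapse) (hs : step p o W = some W') (h : SufInv y a R W) :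
    SufInv y a R W' ∨ (o = .pop2 ∧ W' = R ∧ R ≠ [] ∧ ∃ u, W = (a, u) :: R) := by
  obtain ⟨L, u, rfl, hL, hu⟩ := h
  have hp' : (y : ℤ) < p := by exact_mod_cast hp
  cases L with
  | nil =>
    cases o with
    | push1 s =>
      simp [_root_.step] at hs; subst hs
      left; exact ⟨[], _, rfl, by simp [AllAnn], by simpa [hp] using hu⟩
    | pop1 =>
      cases u with
      | nil => simp [_root_.step] at hs
      | cons x u =>
        simp [_root_.step] at hs; subst hs
        left; exact ⟨[], _, rfl, by simp [AllAnn], fun s hs => hu s (by simp [hs])⟩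
    | push2 =>
      simp [_root_.step] at hs; subst hs
      left
      refine ⟨[((p : ℤ), u)], u, rfl, ?_, hu⟩
      intro e he
      simp at he; subst he
      exact ⟨hp', hu⟩
    | pop2 =>
      right
      cases R with
      | nil => simp [_root_.step] at hs
      | cons r R => simp [_root_.step] at hs; subst hs; simp
    | collapse => exact absurd rfl ho
  | cons e L =>
    left
    obtain ⟨b, v⟩ := e
    have key : ∃ L', W' = L' ++ (a, u) :: R ∧
        AllAnn (fun x => (y : ℤ) < x) (fun x => (y : ℤ) < x) L' := by
      have hb := hL (b, v) (by simp)
      have hT : AllAnn (fun x => (y : ℤ) < x) (fun x => (y : ℤ) < x) L :=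
        fun e he => hL e (by simp [he])
      cases o with
      | push1 s =>
        simp [_root_.step] at hs; subst hs
        refine ⟨(b, _ :: v) :: L, rfl, ?_⟩
        simp [AllAnn] at *; grind
      | pop1 =>
        cases v with
        | nil => simp [_root_.step] at hs
        | cons x v =>
          simp [_root_.step] at hs; subst hs
          refine ⟨(b, v) :: L, rfl, ?_⟩
          simp [AllAnn] at *; grind
      | push2 =>
        simp [_root_.step] at hs; subst hs
        refine ⟨((p : ℤ), v) :: (b, v) :: L, rfl, ?_⟩
        simp [AllAnn] at *; grind
      | pop2 =>
        refine ⟨L, ?_, hT⟩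
        cases L with
        | nil => simp [_root_.step] at hs; simp [hs]
        | cons r L => simp [_root_.step] at hs; simp [hs]
      | collapse => exact absurd rfl ho
    obtain ⟨L', h1, h2⟩ := key
    exact ⟨L', u, h1, h2, hu⟩

theorem main_inv {S : Type} (ops : List (Op S)) (hv : Valid ops) (hcf : Op.collapse ∉ ops)
    (y : ℕ) (a : ℤ) (R : Stk2 S) (hy : st ops (y + 1) = some ((a, []) :: R))
    (t : ℕ) (hyt : y + 1 ≤ t) (ht : t ≤ ops.length) (W : Stk2 S) (hW : st ops t = some W) :
    SufInv y a R W ∨ ∃ (b t₀ : ℕ), (b : ℤ) = a ∧ y < t₀ ∧ t₀ < t ∧ Nest2 ops b t₀ ∧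
      st ops (t₀ + 1) = some R := by
  induction t, hyt using Nat.le_induction generalizing W with
  | base =>
    rw [hy] at hW; cases hW
    left; exact ⟨[], [], rfl, by simp [AllAnn], by simp⟩
  | succ n hn ih =>
    have hl : n < ops.length := by omega
    have hW' := hW
    have hop := List.getElem?_eq_getElem hl
    rw [st_succ ops n _ hop] at hW
    obtain ⟨U, hU, hs⟩ := Option.bind_eq_some_iff.1 hW
    rcases ih (by omega) U hU with h | ⟨b, t₀, h1, h2, h3, h4⟩
    · have hc : ops[n] ≠ .collapse := by
        intro h; exact hcf (h ▸ List.getElem_mem hl)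
      rcases h.step (by omega) hc hs with h | ⟨h1, h2, h3, u, h4⟩
      · exact Or.inl h
      · right
        have hB := st_base ops hcf n (by omega) U hU
        subst h4
        have ha : 0 ≤ a := by
          obtain ⟨r, R', rfl⟩ := List.exists_cons_of_ne_nil h3
          have e1 := hB.pw
          have e2 := (hB.ann r (by simp)).1
          simp at e1 e2
          omega
        obtain ⟨b, rfl⟩ := Int.eq_ofNat_of_zero_le ha
        refine ⟨b, n, rfl, by omega, by omega, Nest2.intro (h1 ▸ hop) hU, ?_⟩
        rw [hW', h2]
    · exact Or.inr ⟨b, t₀, h1, h2, by omega, h4⟩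

/-- **context-suffixes are disconnected.** Let `N` be a collapse-free 2-NW
whose first position `0` executes an order-1 push and let `y` be any `↷1`-pop of `0`.
The context-suffix of `y` is `{x | y < x < ctxt-pop(y)}` if `y` has a context-pop and
`{x | y < x}` if `y` is top-level.  Every `↷1` or `↷2` edge with one endpoint in the
context-suffix of `y` has both endpoints in it. -/
theorem ctxt_suffix_disconnected {S : Type} (ops : List (Op S)) (hv : Valid ops)
    (hcf : Op.collapse ∉ ops)
    (s₀ : S) (h₀ : ops[0]? = some (Op.push1 s₀)) :
    ∀ y, Nest1 ops 0 y →
      ∀ i j, (Nest1 ops i j ∨ Nest2 ops i j) →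
        (TopLevel ops y → (y < i ↔ y < j)) ∧
        (∀ c, CtxtPop ops y c → ((y < i ∧ i < c) ↔ (y < j ∧ j < c))) := by
  intro y hy0 i j hij
  obtain ⟨hypop, a, s, k, u, R, hsty⟩ := hy0.elim
  have hyl : y < ops.length := (List.getElem?_eq_some_iff.1 hypop).1
  have hB := st_base ops hcf y hyl.le _ hsty
  have hu : u = [] := by
    cases u with
    | nil => rfl
    | cons x u =>
      have e1 := hB.pw1 _ (List.mem_cons_self)
      have e2 := (hB.ann _ (List.mem_cons_self)).2 x (by simp)
      simp at e1 e2
      omega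
  subst hu
  have hy1 : st ops (y + 1) = some ((a, []) :: R) := by
    rw [st_succ ops y _ hypop, hsty]; rfl
  have hay : a < y := by
    have := (hB.ann _ (List.mem_cons_self)).1; simp at this; omega
  have hRa : AllAnn (fun x => x < a) (fun x => x < (y : ℤ)) R := by
    intro e he
    have e1 := hB.pw
    have e2 := hB.ann e (by simp [he])
    refine ⟨(List.pairwise_cons.1 e1).1 e he, fun s hs => (e2.2 s hs).2⟩
  -- facts about the edge
  have hjl : j < ops.length := by
    rcases hij with h | h
    · exact (List.getElem?_eq_some_iff.1 h.1).1
    · exact (List.getElem?_eq_some_iff.1 (h.elim hcf).1).1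
  obtain ⟨W, hW⟩ := st_some ops hv j
  have hprop : ∀ P : ℤ → Prop, AllAnn P P W → P i := by
    intro P hP
    rcases hij with h | h
    · obtain ⟨_, a', s', k', u', R', e⟩ := h.elim
      rw [hW] at e; cases e
      exact (hP _ (List.mem_cons_self)).2 _ (List.mem_cons_self)
    · obtain ⟨_, u', R', e⟩ := h.elim hcf
      rw [hW] at e; cases e
      exact (hP _ (List.mem_cons_self)).1
  have hijlt : i < j := by
    have := hprop (fun x => x < j) (fun e he => by
      have := (st_base ops hcf j hjl.le W hW).ann e he
      exact ⟨this.1.2, fun s hs => (this.2 s hs).2⟩)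
    exact_mod_cast this
  have hsuf : SufInv y a R W → j ≠ y → (y < i ∨ (Nest2 ops i j ∧ (i : ℤ) = a ∧
      st ops j = some W ∧ ∃ u, W = (a, u) :: R)) := by
    rintro ⟨L, v, rfl, hL, hv⟩ -
    rcases hij with h | h
    · obtain ⟨_, a', s', k', u', R', e⟩ := h.elim
      rw [hW] at e
      left
      cases L with
      | nil =>
        simp at e
        have := hv (s', k', (i : ℤ)) (by simp [e.1.2])
        simpa using this
      | cons x L =>
        simp at e
        have := (hL x (by simp)).2 (s', k', (i : ℤ)) (by simp [e.1])
        simpa using this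
    · obtain ⟨_, u', R', e⟩ := h.elim hcf
      rw [hW] at e
      cases L with
      | nil =>
        simp at e
        right
        exact ⟨h, e.1.1.symm, hW, v, rfl⟩
      | cons x L =>
        simp at e
        left
        have := (hL x (by simp)).1
        simpa [e.1] using this
  constructor
  · intro htop
    refine ⟨fun h => by omega, fun h => ?_⟩
    rcases main_inv ops hv hcf y a R hy1 j (by omega) hjl.le W hW with h1 | ⟨b, t₀, h1, h2, h3, h4, h5⟩
    · rcases hsuf h1 (by omega) with h2 | ⟨h2, h3, _⟩
      · exact h2
      · exact absurd ⟨i, j, h2, by omega, h⟩ htop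
    · exact absurd ⟨b, t₀, h4, by omega, h2⟩ htop
  · rintro c ⟨z, hzc, hzy, hyc, hinner⟩
    obtain ⟨hcpop, uc, Rc, hstc⟩ := hzc.elim hcf
    have hcl : c < ops.length := (List.getElem?_eq_some_iff.1 hcpop).1
    have hno : ∀ b t₀ : ℕ, (b : ℤ) = a → y < t₀ → t₀ < c → Nest2 ops b t₀ →
        st ops (t₀ + 1) = some R → False := by
      intro b t₀ h1 h2 h3 h4 h5
      have := ann_mono ops hv hcf (P := fun x => x < a ∨ (t₀ : ℤ) < x) (Q := fun _ => True)
        (t₀ + 1) c (by omega) hcl.le (fun k hk => by right; omega) (fun _ _ => trivial)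
        R _ h5 hstc (fun e he => ⟨Or.inl (hRa e he).1, fun _ _ => trivial⟩)
      have h6 := (this _ (List.mem_cons_self)).1
      simp only at h6
      exact hinner ⟨b, t₀, h4, by omega, by omega, h2, h3⟩
    have hc : (z : ℤ) = a ∧ Rc = R := by
      rcases main_inv ops hv hcf y a R hy1 c (by omega) hcl.le _ hstc with h | ⟨b, t₀, h1, h2, h3, h4, h5⟩
      · obtain ⟨L, v, e, hL, _⟩ := h
        cases L with
        | nil => simp at e; exact ⟨e.1.1, e.2⟩
        | cons x L =>
          simp at e
          have := (hL x (by simp)).1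
          rw [← e.1] at this
          simp only at this
          omega
      · exact (hno b t₀ h1 h2 h3 h4 h5).elim
    obtain ⟨hza, rfl⟩ := hc
    constructor
    · rintro ⟨h1, h2⟩
      refine ⟨by omega, ?_⟩
      by_contra hjc
      rcases Nat.lt_or_ge c j with h3 | h3
      · obtain ⟨V, hV⟩ := st_some ops hv (c + 1)
        have hV' := hV
        rw [st_succ ops c _ hcpop, hstc] at hV
        have hVR : V = Rc := by
          cases Rc with
          | nil => simp [step] at hV
          | cons r Rc => simp [step] at hV; exact hV.symm
        subst hVR
        have := hprop _ (ann_mono ops hv hcf (P := fun x => x < (y : ℤ) ∨ (c : ℤ) < x)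
          (Q := fun x => x < (y : ℤ) ∨ (c : ℤ) < x)
          (c + 1) j (by omega) hjl.le (fun k hk => by right; omega) (fun k hk => by right; omega)
          V W hV' hW (fun e he => ⟨Or.inl (by have := (hRa e he).1; simp only at this; omega),
            fun s hs => Or.inl ((hRa e he).2 s hs)⟩))
        omega
      · obtain rfl : j = c := by omega
        rcases hij with h | h
        · rw [h.elim.1] at hcpop; simp at hcpop
        · obtain ⟨_, u', R', e⟩ := h.elim hcf
          rw [hstc] at e
          simp at e
          omega
    · rintro ⟨h1, h2⟩
      refine ⟨?_, by omega⟩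
      rcases main_inv ops hv hcf y a Rc hy1 j (by omega) hjl.le W hW with h | ⟨b, t₀, g1, g2, g3, g4, g5⟩
      · rcases hsuf h (by omega) with h | ⟨g1, g2, g3, v, rfl⟩
        · exact h
        · exfalso
          have hop := (g1.elim hcf).1
          obtain ⟨V, hV⟩ := st_some ops hv (j + 1)
          have hV' := hV
          rw [st_succ ops j _ hop, hW] at hV
          have hVR : V = Rc := by
            cases Rc with
            | nil => simp [step] at hV
            | cons r Rc => simp [step] at hV; exact hV.symm
          subst hVR
          exact hno i j g2 h1 h2 g1 hV'
      · exact (hno b t₀ g1 g2 (by omega) g4 g5).elim
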